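/- arXiv:2012.09956 — 2 statements merged into one kernel-verified Lean document; each statement's English description precedes it below -/
import Mathlib

section
/- For every SED-pair (G,f) of order n and every positive integer k, there exists a SED-pair (G',f') of order kn + 1 with s[(G',f')] ≤ k²·s[(G,f)] + nk. -/
open Finset

/-- The value `s_v`: the sum of weights of edges incident to `v`. -/
def sVert {V : Type*} [Fintype V] [DecidableEq V] (G : SimpleGraph V) [DecidableRel G.Adj]
    (f : Sym2 V → ℤ) (v : V) : ℤ :=
  ∑ e ∈ G.edgeFinset.filter (fun e => v ∈ e), f e

/-- The total weight `s[(G,f)]`: the sum of weights over all edges. -/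
def sSum {V : Type*} [Fintype V] [DecidableEq V] (G : SimpleGraph V) [DecidableRel G.Adj]
    (f : Sym2 V → ℤ) : ℤ :=
  ∑ e ∈ G.edgeFinset, f e

/-- `(G, f)` is a SED-pair: `f` takes values `±1` on edges, and the sum of `f` over the
closed edge-neighborhood `N[e]` (edges sharing a vertex with `e`, including `e` itself)
is at least `1` for every edge `e`. -/
def IsSEDPair {V : Type*} [Fintype V] [DecidableEq V] (G : SimpleGraph V) [DecidableRel G.Adj]
    (f : Sym2 V → ℤ) : Prop :=
  (∀ e ∈ G.edgeFinset, f e = 1 ∨ f e = -1) ∧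
  (∀ e ∈ G.edgeFinset,
    1 ≤ ∑ e' ∈ G.edgeFinset.filter (fun e' => ∃ v, v ∈ e ∧ v ∈ e'), f e')

section SEDPair

variable {V : Type*} [Fintype V] [DecidableEq V] (G : SimpleGraph V) [DecidableRel G.Adj]
  (f : Sym2 V → ℤ)

theorem sVert_eq_sum_adj (v : V) :
    sVert G f v = ∑ w, if G.Adj v w then f s(v, w) else 0 := by
  rw [← Finset.sum_filter, sVert]
  symm
  refine Finset.sum_bij (fun w _ => s(v, w)) ?_ ?_ ?_ ?_
  · intro w hw
    simpa using hw
  · intro a _ b _ hab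
    exact Sym2.congr_right.mp hab
  · intro e he
    simp only [mem_filter, SimpleGraph.mem_edgeFinset] at he
    obtain ⟨w, rfl⟩ := Sym2.mem_iff_exists.mp he.2
    exact ⟨w, by simpa using he.1, rfl⟩
  · intros
    rfl

theorem two_mul_sSum : 2 * sSum G f = ∑ v, sVert G f v := by
  simp only [sVert, sSum, Finset.sum_filter]
  rw [Finset.sum_comm, Finset.mul_sum]
  refine Finset.sum_congr rfl fun e he => ?_
  induction e with
  | _ a b =>
    have hab : a ≠ b := G.ne_of_adj (by simpa using he)
    have hfilter : Finset.univ.filter (fun v => v ∈ s(a, b)) = {a, b} := by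
      ext v
      simp
    rw [← Finset.sum_filter, hfilter, Finset.sum_pair hab, two_mul]

/-- The weight of the closed neighbourhood of an edge `ab` is `s_a + s_b - f(ab)`. -/
theorem sum_closedNeighborhood {a b : V} (hab : G.Adj a b) :
    ∑ e ∈ G.edgeFinset.filter (fun e => ∃ v, v ∈ s(a, b) ∧ v ∈ e), f e =
      sVert G f a + sVert G f b - f s(a, b) := by
  have hunion : G.edgeFinset.filter (fun e => ∃ v, v ∈ s(a, b) ∧ v ∈ e) =
      G.edgeFinset.filter (fun e => a ∈ e) ∪ G.edgeFinset.filter (fun e => b ∈ e) := by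
    ext e
    simp [and_or_left]
  have hinter : G.edgeFinset.filter (fun e => a ∈ e) ∩ G.edgeFinset.filter (fun e => b ∈ e) =
      {s(a, b)} := by
    ext e
    simp only [mem_inter, mem_filter, SimpleGraph.mem_edgeFinset, mem_singleton]
    constructor
    · rintro ⟨⟨_, ha⟩, _, hb⟩
      exact (Sym2.mem_and_mem_iff hab.ne).mp ⟨ha, hb⟩
    · rintro rfl
      simpa using hab
  have hsum := Finset.sum_union_inter (s₁ := G.edgeFinset.filter (fun e => a ∈ e))
    (s₂ := G.edgeFinset.filter (fun e => b ∈ e)) (f := f)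
  rw [hinter, Finset.sum_singleton] at hsum
  rw [hunion, sVert, sVert]
  linarith

theorem isSEDPair_iff : IsSEDPair G f ↔
    ∀ a b, G.Adj a b → (f s(a, b) = 1 ∨ f s(a, b) = -1) ∧
      1 ≤ sVert G f a + sVert G f b - f s(a, b) := by
  constructor
  · rintro ⟨hval, hnbr⟩ a b hab
    have he : s(a, b) ∈ G.edgeFinset := by simpa using hab
    exact ⟨hval _ he, sum_closedNeighborhood G f hab ▸ hnbr _ he⟩
  · intro h
    refine ⟨fun e he => ?_, fun e he => ?_⟩ <;> induction e with | _ a b => ?_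
    · exact (h a b (by simpa using he)).1
    · have hab : G.Adj a b := by simpa using he
      rw [sum_closedNeighborhood G f hab]
      exact (h a b hab).2

end SEDPair

section Blowup

variable {V W : Type*} (p : W → Option V)

/-- The blow-up of `G` along `p : W → Option V`: each vertex `v` is replaced by the independent
set of all `x` with `p x = some v`, and the vertices sent to `none` are isolated. -/
def blowupGraph (G : SimpleGraph V) : SimpleGraph W :=
  (G.map Function.Embedding.some).comap p

/-- The weights of `f` pulled back to the blow-up along `p`. -/
noncomputable def blowupWeight (f : Sym2 V → ℤ) : Sym2 W → ℤ :=
  fun e => Function.extend (Sym2.map some) f 0 (Sym2.map p e)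

variable {p}

theorem blowupGraph_adj {G : SimpleGraph V} {x y : W} :
    (blowupGraph p G).Adj x y ↔ ∃ a b, G.Adj a b ∧ p x = some a ∧ p y = some b := by
  rw [blowupGraph, SimpleGraph.comap_adj, SimpleGraph.map_adj]
  simp [eq_comm]

theorem blowupWeight_mk (f : Sym2 V → ℤ) {x y : W} {a b : V} (hx : p x = some a)
    (hy : p y = some b) : blowupWeight p f s(x, y) = f s(a, b) := by
  have hinj : Function.Injective (Sym2.map (some : V → Option V)) :=
    Sym2.map.injective (Option.some_injective V)
  rw [blowupWeight, Sym2.map_mk, hx, hy, ← Sym2.map_mk, hinj.extend_apply]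

variable [Fintype W] [DecidableEq W] {G : SimpleGraph V} [DecidableRel (blowupGraph p G).Adj]
  {f : Sym2 V → ℤ}

theorem sVert_blowup_of_none {x : W} (hx : p x = none) :
    sVert (blowupGraph p G) (blowupWeight p f) x = 0 := by
  simp [sVert_eq_sum_adj, blowupGraph_adj, hx]

variable [Fintype V] [DecidableEq V] [DecidableRel G.Adj] {k : ℕ}

theorem sVert_blowup_of_some
    (hp : ∀ g : Option V → ℤ, ∑ x, g (p x) = g none + k * ∑ v, g (some v))
    {x : W} {a : V} (hx : p x = some a) :
    sVert (blowupGraph p G) (blowupWeight p f) x = k * sVert G f a := by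
  have hfun := hp fun o => o.elim 0 fun b => if G.Adj a b then f s(a, b) else 0
  simp only [Option.elim_none, Option.elim_some, zero_add] at hfun
  rw [sVert_eq_sum_adj, sVert_eq_sum_adj, ← hfun]
  refine Finset.sum_congr rfl fun y _ => ?_
  cases hy : p y with
  | none => simp [blowupGraph_adj, hy]
  | some b => simp [blowupGraph_adj, hx, hy, blowupWeight_mk f hx hy]

theorem sSum_blowup
    (hp : ∀ g : Option V → ℤ, ∑ x, g (p x) = g none + k * ∑ v, g (some v)) :
    sSum (blowupGraph p G) (blowupWeight p f) = (k : ℤ) ^ 2 * sSum G f := by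
  have hfun := hp fun o => o.elim 0 fun b => k * sVert G f b
  simp only [Option.elim_none, Option.elim_some, zero_add] at hfun
  have hsum : ∑ x, sVert (blowupGraph p G) (blowupWeight p f) x =
      k * ∑ v, k * sVert G f v := by
    rw [← hfun]
    refine Finset.sum_congr rfl fun x _ => ?_
    cases hx : p x with
    | none => simp [sVert_blowup_of_none hx]
    | some b => simp [sVert_blowup_of_some hp hx]
  rw [← two_mul_sSum, ← Finset.mul_sum, ← two_mul_sSum] at hsum
  linarith

theorem IsSEDPair.blowup
    (hp : ∀ g : Option V → ℤ, ∑ x, g (p x) = g none + k * ∑ v, g (some v))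
    (hk : 0 < k) (h : IsSEDPair G f) :
    IsSEDPair (blowupGraph p G) (blowupWeight p f) := by
  rw [isSEDPair_iff] at h ⊢
  intro x y hxy
  obtain ⟨a, b, hab, hx, hy⟩ := blowupGraph_adj.mp hxy
  obtain ⟨hval, hnbr⟩ := h a b hab
  rw [blowupWeight_mk f hx hy, sVert_blowup_of_some hp hx, sVert_blowup_of_some hp hy]
  refine ⟨hval, ?_⟩
  have hk' : (1 : ℤ) ≤ k := by exact_mod_cast hk
  rcases hval with hval | hval <;> rw [hval] at hnbr ⊢ <;> nlinarith

end Blowup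

/-- For every SED-pair `(G, f)` of order `n` and every positive integer `k`,
there exists a SED-pair `(G', f')` of order `kn + 1` with
`s[(G',f')] ≤ k²·s[(G,f)] + n·k`. -/
theorem sed_blowup {V : Type*} [Fintype V] [DecidableEq V]
    (G : SimpleGraph V) [DecidableRel G.Adj] (f : Sym2 V → ℤ)
    (h : IsSEDPair G f) (k : ℕ) (hk : 0 < k) :
    ∃ (G' : SimpleGraph (Fin (k * Fintype.card V + 1))) (_ : DecidableRel G'.Adj)
      (f' : Sym2 (Fin (k * Fintype.card V + 1)) → ℤ),
      IsSEDPair G' f' ∧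
      sSum G' f' ≤ (k : ℤ) ^ 2 * sSum G f + (Fintype.card V : ℤ) * (k : ℤ) := by
  classical
  let e : Fin (k * Fintype.card V + 1) ≃ Option (V × Fin k) :=
    Fintype.equivOfCardEq (by simp [mul_comm])
  let p : Fin (k * Fintype.card V + 1) → Option V := fun x => (e x).map Prod.fst
  have hp : ∀ g : Option V → ℤ, ∑ x, g (p x) = g none + k * ∑ v, g (some v) := by
    intro g
    rw [e.sum_comp fun o => g (o.map Prod.fst), Fintype.sum_option, Fintype.sum_prod_type]
    simp [Finset.mul_sum]
  refine ⟨blowupGraph p G, inferInstance, blowupWeight p f, h.blowup hp hk, ?_⟩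
  rw [sSum_blowup hp]
  exact le_add_of_nonneg_right (by positivity)
end

section
/- Let (G,f) be a SED-pair such that every edge e with f(e) = −1 joins a vertex of V_+ with a vertex of V_−, and every edge e with f(e) = +1 joins two vertices of V_+. Then for every edge (u,w) with f((u,w)) = −1, u ∈ V_+ and w ∈ V_−, one has a_u − b_u ≥ c_w, where a_u is the number of edges joining u to vertices of V_+, b_u is the number of edges joining u to vertices of V_−, and c_w is the degree of w in G. -/
open Finset

/-- The vertex weight as a sum over neighbors. -/
lemma sVert_eq_sum_neighborFinset {V : Type*} [Fintype V] [DecidableEq V]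
    (G : SimpleGraph V) [DecidableRel G.Adj] (f : Sym2 V → ℤ) (v : V) :
    sVert G f v = ∑ x ∈ G.neighborFinset v, f s(v, x) := by
  symm
  unfold sVert
  refine Finset.sum_bij (fun x _ => s(v, x)) ?_ ?_ ?_ ?_
  · intro x hx
    simpa using hx
  · intro x _ y _ hxy
    exact Sym2.congr_right.mp hxy
  · intro e he
    obtain ⟨he, x, rfl⟩ := Finset.mem_filter.mp he
    exact ⟨x, by simpa using he, rfl⟩
  · intro x _
    rfl

/-- The weight of the closed neighborhood of an edge in terms of the weights of its ends. -/
lemma sum_closed_edge_neighborhood {V : Type*} [Fintype V] [DecidableEq V]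
    (G : SimpleGraph V) [DecidableRel G.Adj] (f : Sym2 V → ℤ) {u w : V} (huw : G.Adj u w) :
    ∑ e ∈ G.edgeFinset.filter (fun e => ∃ v, v ∈ s(u, w) ∧ v ∈ e), f e =
      sVert G f u + sVert G f w - f s(u, w) := by
  have hunion : G.edgeFinset.filter (fun e => ∃ v, v ∈ s(u, w) ∧ v ∈ e) =
      G.edgeFinset.filter (fun e => u ∈ e) ∪ G.edgeFinset.filter (fun e => w ∈ e) := by
    ext e
    simp [and_or_left]
  have hinter : G.edgeFinset.filter (fun e => u ∈ e) ∩ G.edgeFinset.filter (fun e => w ∈ e) =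
      {s(u, w)} := by
    ext e
    rw [← Finset.filter_and, Finset.mem_filter, Sym2.mem_and_mem_iff huw.ne,
      Finset.mem_singleton, and_iff_right_iff_imp]
    rintro rfl
    simpa using huw
  have hsum := Finset.sum_union_inter (s₁ := G.edgeFinset.filter (fun e => u ∈ e))
    (s₂ := G.edgeFinset.filter (fun e => w ∈ e)) (f := f)
  rw [hinter, Finset.sum_singleton, ← hunion] at hsum
  exact eq_sub_of_add_eq hsum

/-- Let `(G, f)` be a SED-pair in which every edge of weight `-1` joins a
vertex of `V₊` with a vertex of `V₋`, and every edge of weight `+1` joins two vertices of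
`V₊`. Then for every edge `(u, w)` with `f (u,w) = -1`, `u ∈ V₊` and `w ∈ V₋`, one has
`a_u - b_u ≥ c_w`, where `a_u` (resp. `b_u`) is the number of edges joining `u` to vertices
of `V₊` (resp. `V₋`), and `c_w` is the degree of `w`. -/
theorem sed_edge_degree_ineq {V : Type*} [Fintype V] [DecidableEq V]
    (G : SimpleGraph V) [DecidableRel G.Adj] (f : Sym2 V → ℤ)
    (h : IsSEDPair G f)
    (hneg : ∀ u w : V, G.Adj u w → f s(u, w) = -1 →
      (0 ≤ sVert G f u ∧ sVert G f w < 0) ∨ (0 ≤ sVert G f w ∧ sVert G f u < 0))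
    (hpos : ∀ u w : V, G.Adj u w → f s(u, w) = 1 →
      0 ≤ sVert G f u ∧ 0 ≤ sVert G f w)
    (u w : V) (huw : G.Adj u w) (hf : f s(u, w) = -1)
    (hu : 0 ≤ sVert G f u) (hw : sVert G f w < 0) :
    (((G.neighborFinset u).filter (fun v => 0 ≤ sVert G f v)).card : ℤ) -
        (((G.neighborFinset u).filter (fun v => sVert G f v < 0)).card : ℤ) ≥
      (G.degree w : ℤ) := by
  have hsed := h.2 s(u, w) (by simpa using huw)
  rw [sum_closed_edge_neighborhood G f huw, hf] at hsed
  have hval (x y : V) (hxy : G.Adj x y) : f s(x, y) = 1 ∨ f s(x, y) = -1 :=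
    h.1 _ (by simpa using hxy)
  have hsw : sVert G f w = -(G.degree w : ℤ) := by
    rw [sVert_eq_sum_neighborFinset, ← G.card_neighborFinset_eq_degree,
      Finset.sum_congr rfl (g := fun _ => (-1 : ℤ))]
    · simp
    · intro x hx
      rw [SimpleGraph.mem_neighborFinset] at hx
      exact (hval w x hx).resolve_left fun h1 => hw.not_ge (hpos w x hx h1).1
  have hsu : sVert G f u =
      (((G.neighborFinset u).filter (fun v => 0 ≤ sVert G f v)).card : ℤ) -
        (((G.neighborFinset u).filter (fun v => sVert G f v < 0)).card : ℤ) := by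
    rw [sVert_eq_sum_neighborFinset, Finset.card_filter, Finset.card_filter]
    push_cast
    rw [← Finset.sum_sub_distrib]
    refine Finset.sum_congr rfl fun x hx => ?_
    rw [SimpleGraph.mem_neighborFinset] at hx
    rcases hval u x hx with h1 | h1
    · have hx0 := (hpos u x hx h1).2
      simp [h1, hx0, hx0.not_gt]
    · have hx0 : sVert G f x < 0 := by
        rcases hneg u x hx h1 with h2 | h2
        · exact h2.2
        · exact absurd h2.2 hu.not_gt
      simp [h1, hx0, hx0.not_ge]
  linarith
end
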